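/- Let X be a conjugacy class of involutions in G_n with labelled cycle type (0,k_e,k_o,l) where m = 0 and l ≥ 1. Then: Diam C(G_n,X) = 2 if 2l ≥ n; Diam C(G_n,X) = ⌈n/l⌉ if 0 ∈ {k_e,k_o} (and 2l < n); Diam C(G_n,X) = n+1 if l = 1 and both k_e and k_o are nonzero; and in all other cases ⌈n/l⌉ ≤ Diam C(G_n,X) ≤ ⌈n/l⌉ + 2. -/

import Mathlib

/-!
Common setup: the affine Weyl group of type C̃ₙ, realized as the semidirect
product of the group Wₙ of signed permutations of {1,…,n} with the translation
lattice ℤⁿ.  An element is a triple `(π, s, v)`, where `π` is the underlying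
permutation of the n points, `s i` is the sign attached to the point `i`
(so the signed permutation maps the point `i` to the point `π i` with sign `s i`),
and `v ∈ ℤⁿ` is the translation part.  The multiplication realizes
`(α,v)(τ,u) = (ατ, vᵗ + u)`.
-/

/-- An element of the affine Weyl group of type C̃ₙ: a signed permutation
`(π, s)` together with a translation vector `v ∈ ℤⁿ`. -/
@[ext]
structure AffineWeylC (n : ℕ) where
  π : Equiv.Perm (Fin n)
  s : Fin n → ℤˣ
  v : Fin n → ℤ

namespace AffineWeylC

variable {n : ℕ}

instance : One (AffineWeylC n) := ⟨⟨1, 1, 0⟩⟩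

instance : Mul (AffineWeylC n) :=
  ⟨fun g h => ⟨h.π * g.π, fun j => g.s j * h.s (g.π j),
    fun i => (h.s (h.π⁻¹ i) : ℤ) * g.v (h.π⁻¹ i) + h.v i⟩⟩

instance : Inv (AffineWeylC n) :=
  ⟨fun g => ⟨g.π⁻¹, fun k => (g.s (g.π⁻¹ k))⁻¹,
    fun i => -(((g.s i)⁻¹ : ℤˣ) : ℤ) * g.v (g.π i)⟩⟩

@[simp] lemma mul_π (g h : AffineWeylC n) : (g * h).π = h.π * g.π := rfl
@[simp] lemma mul_s (g h : AffineWeylC n) (j : Fin n) :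
    (g * h).s j = g.s j * h.s (g.π j) := rfl
@[simp] lemma mul_v (g h : AffineWeylC n) (i : Fin n) :
    (g * h).v i = (h.s (h.π⁻¹ i) : ℤ) * g.v (h.π⁻¹ i) + h.v i := rfl
@[simp] lemma one_π : (1 : AffineWeylC n).π = 1 := rfl
@[simp] lemma one_s (j : Fin n) : (1 : AffineWeylC n).s j = 1 := rfl
@[simp] lemma one_v (i : Fin n) : (1 : AffineWeylC n).v i = 0 := rfl
@[simp] lemma inv_π (g : AffineWeylC n) : g⁻¹.π = g.π⁻¹ := rfl
@[simp] lemma inv_s (g : AffineWeylC n) (k : Fin n) :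
    g⁻¹.s k = (g.s (g.π⁻¹ k))⁻¹ := rfl
@[simp] lemma inv_v (g : AffineWeylC n) (i : Fin n) :
    g⁻¹.v i = -(((g.s i)⁻¹ : ℤˣ) : ℤ) * g.v (g.π i) := rfl

instance : Group (AffineWeylC n) where
  mul_assoc a b c := by
    refine AffineWeylC.ext ?_ (funext fun j => ?_) (funext fun i => ?_)
    · simp [mul_assoc]
    · simp only [mul_s, mul_π, Equiv.Perm.mul_apply]
      rw [mul_assoc]
    · simp only [mul_v, mul_s, mul_π, mul_inv_rev, Equiv.Perm.mul_apply,
        show ∀ (e : Equiv.Perm (Fin n)) (x : Fin n), e (e⁻¹ x) = x from Equiv.apply_symm_apply,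
        Units.val_mul]
      ring
  one_mul a := by
    refine AffineWeylC.ext ?_ (funext fun j => ?_) (funext fun i => ?_) <;>
      simp
  mul_one a := by
    refine AffineWeylC.ext ?_ (funext fun j => ?_) (funext fun i => ?_) <;>
      simp
  inv_mul_cancel a := by
    refine AffineWeylC.ext ?_ (funext fun j => ?_) (funext fun i => ?_)
    · simp
    · simp
    · simp only [mul_v, inv_v, inv_s, one_v,
        show ∀ (e : Equiv.Perm (Fin n)) (x : Fin n), e (e⁻¹ x) = x from Equiv.apply_symm_apply]
      have h1 : ((a.s (a.π⁻¹ i) : ℤ)) * (((a.s (a.π⁻¹ i))⁻¹ : ℤˣ) : ℤ) = 1 := by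
        rw [← Units.val_mul, mul_inv_cancel, Units.val_one]
      linear_combination (-(a.v i)) * h1

/-- `g` is an involution: a non-identity element squaring to the identity. -/
def Involution (g : AffineWeylC n) : Prop := g ≠ 1 ∧ g * g = 1

/-- The conjugacy class of `a`. -/
def conjClass (a : AffineWeylC n) : Set (AffineWeylC n) := {b | IsConj a b}

/-- The number of transpositions (2-cycles) of the underlying signed permutation. -/
noncomputable def numTrans (g : AffineWeylC n) : ℕ :=
  {i : Fin n | g.π i ≠ i}.ncard / 2

/-- The number of negative 1-cycles of `g` carrying an even label. -/
noncomputable def numNegEven (g : AffineWeylC n) : ℕ :=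
  {i : Fin n | g.π i = i ∧ g.s i = -1 ∧ Even (g.v i)}.ncard

/-- The number of negative 1-cycles of `g` carrying an odd label. -/
noncomputable def numNegOdd (g : AffineWeylC n) : ℕ :=
  {i : Fin n | g.π i = i ∧ g.s i = -1 ∧ Odd (g.v i)}.ncard

/-- The number of positive 1-cycles (fixed points) of `g`. -/
noncomputable def numPos (g : AffineWeylC n) : ℕ :=
  {i : Fin n | g.π i = i ∧ g.s i = 1}.ncard

/-- The labelled cycle type `(m, k_e, k_o, l)` of an involution. -/
noncomputable def cycleType (g : AffineWeylC n) : ℕ × ℕ × ℕ × ℕ :=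
  (numTrans g, numNegEven g, numNegOdd g, numPos g)

/-- `g` has labelled cycle type `(m, k_e, k_o, l)`. -/
def HasType (g : AffineWeylC n) (m ke ko l : ℕ) : Prop :=
  numTrans g = m ∧ numNegEven g = ke ∧ numNegOdd g = ko ∧ numPos g = l

/-- The canonical class representative
`a_{m,k_e,k_o,l} = (1 2)⁺₀ ⋯ (2m−1 2m)⁺₀ (2m+1)⁻₀ ⋯ (2m+k_e)⁻₀
(2m+k_e+1)⁻₁ ⋯ (n−l)⁻₁ (n−l+1)⁺₀ ⋯ (n)⁺₀`
(here written with 0-based indices): points `0,…,2m-1` are paired off into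
label‑0 positive transpositions, points `2m,…,2m+k_e-1` are negative 1-cycles
with label 0, points `2m+k_e,…,2m+k_e+k_o-1` are negative 1-cycles with label 1,
and the remaining `l` points are positive fixed points with label 0. -/
def IsCanon (a : AffineWeylC n) (m ke ko l : ℕ) : Prop :=
  2*m + ke + ko + l = n ∧
  (∀ i : Fin n, i.val < 2*m → i.val % 2 = 0 → (a.π i).val = i.val + 1) ∧
  (∀ i : Fin n, i.val < 2*m → i.val % 2 = 1 → (a.π i).val = i.val - 1) ∧
  (∀ i : Fin n, 2*m ≤ i.val → a.π i = i) ∧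
  (∀ i : Fin n, i.val < 2*m → a.s i = 1 ∧ a.v i = 0) ∧
  (∀ i : Fin n, 2*m ≤ i.val → i.val < 2*m + ke → a.s i = -1 ∧ a.v i = 0) ∧
  (∀ i : Fin n, 2*m + ke ≤ i.val → i.val < 2*m + ke + ko → a.s i = -1 ∧ a.v i = 1) ∧
  (∀ i : Fin n, 2*m + ke + ko ≤ i.val → a.s i = 1 ∧ a.v i = 0)

/-- The labelled positive transposition `(α β)⁺_λ`. -/
def posTrans (α β : Fin n) (lam : ℤ) : AffineWeylC n :=
  ⟨Equiv.swap α β, 1, fun i => if i = α then lam else if i = β then -lam else 0⟩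

/-- The labelled negative transposition `(α β)⁻_λ`. -/
def negTrans (α β : Fin n) (lam : ℤ) : AffineWeylC n :=
  ⟨Equiv.swap α β, fun i => if i = α then -1 else if i = β then -1 else 1,
    fun i => if i = α then lam else if i = β then lam else 0⟩

/-- The labelled negative 1-cycle `(α)⁻_λ`. -/
def negOne (α : Fin n) (lam : ℤ) : AffineWeylC n :=
  ⟨1, fun i => if i = α then -1 else 1, fun i => if i = α then lam else 0⟩

/-- The finite Weyl group Wₙ of type Cₙ, as the subgroup of the affine Weyl
group consisting of the elements with trivial translation part. -/
def WeylSub (n : ℕ) : Subgroup (AffineWeylC n) where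
  carrier := {g | g.v = 0}
  one_mem' := rfl
  mul_mem' := by
    intro g h hg hh
    show (g * h).v = 0
    funext i
    simp only [mul_v]
    rw [show g.v = 0 from hg, show h.v = 0 from hh]
    simp
  inv_mem' := by
    intro g hg
    show g⁻¹.v = 0
    funext i
    simp only [inv_v]
    rw [show g.v = 0 from hg]
    simp

/-- The projection `G_n → W_n`, `(σ, v) ↦ σ`. -/
def weylPart (n : ℕ) : AffineWeylC n →* WeylSub n where
  toFun g := ⟨⟨g.π, g.s, 0⟩, rfl⟩
  map_one' := by
    apply Subtype.ext
    refine AffineWeylC.ext rfl rfl rfl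
  map_mul' g h := by
    apply Subtype.ext
    refine AffineWeylC.ext rfl rfl (funext fun i => ?_)
    simp

end AffineWeylC

/-- The commuting graph on a subset `X` of a group: the vertices are the
elements of `X`, and distinct vertices are adjacent iff they commute. -/
def commGraph {G : Type*} [Group G] (X : Set G) : SimpleGraph X where
  Adj x y := (x : G) ≠ (y : G) ∧ Commute (x : G) (y : G)
  symm := ⟨fun _ _ h => ⟨fun e => h.1 e.symm, h.2.symm⟩⟩
  loopless := ⟨fun _ h => h.1 rfl⟩


set_option linter.unusedSectionVars false

/-- The kind of a label: absent, even or odd. -/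
def kind (o : Option ℤ) : Option Bool := o.map fun z => decide (Even z)

@[simp] lemma kind_none : kind none = none := rfl

lemma kind_eq_none {o : Option ℤ} : kind o = none ↔ o = none := by
  simp [kind]

section Finset

variable {ι : Type*} [DecidableEq ι] {S T C : Finset ι} {f g k : ι → Option Bool}

/-- `f` and `g` take every value equally often on `S`. -/
def BalancedOn (S : Finset ι) (f g : ι → Option Bool) : Prop :=
  ∀ c, (S.filter fun i => f i = c).card = (S.filter fun i => g i = c).card

lemma BalancedOn.refl (S : Finset ι) (f : ι → Option Bool) : BalancedOn S f f := fun _ => rfl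

lemma BalancedOn.symm (h : BalancedOn S f g) : BalancedOn S g f := fun c => (h c).symm

lemma BalancedOn.trans (h : BalancedOn S f g) (h' : BalancedOn S g k) : BalancedOn S f k :=
  fun c => (h c).trans (h' c)

lemma BalancedOn.congr {f' g' : ι → Option Bool} (h : BalancedOn S f g) (hf : ∀ i ∈ S, f i = f' i)
    (hg : ∀ i ∈ S, g i = g' i) : BalancedOn S f' g' := by
  intro c
  have h1 : (S.filter fun i => f i = c) = S.filter fun i => f' i = c :=
    Finset.filter_congr fun i hi => by rw [hf i hi]
  have h2 : (S.filter fun i => g i = c) = S.filter fun i => g' i = c :=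
    Finset.filter_congr fun i hi => by rw [hg i hi]
  rw [← h1, ← h2]
  exact h c

lemma BalancedOn.union (hST : Disjoint S T) (hS : BalancedOn S f g) (hT : BalancedOn T f g) :
    BalancedOn (S ∪ T) f g := by
  intro c
  rw [Finset.filter_union, Finset.filter_union,
    Finset.card_union_of_disjoint (Finset.disjoint_filter_filter hST),
    Finset.card_union_of_disjoint (Finset.disjoint_filter_filter hST), hS c, hT c]

lemma BalancedOn.sdiff (hC : C ⊆ S) (hS : BalancedOn S f g) (hCb : BalancedOn C f g) :
    BalancedOn (S \ C) f g := by
  intro c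
  have key : ∀ k : ι → Option Bool, ((S \ C).filter fun i => k i = c).card +
      (C.filter fun i => k i = c).card = (S.filter fun i => k i = c).card := by
    intro k
    rw [← Finset.card_union_of_disjoint
      (Finset.disjoint_filter_filter Finset.sdiff_disjoint), ← Finset.filter_union,
      Finset.sdiff_union_of_subset hC]
  have h1 := key f
  have h2 := key g
  have h3 := hS c
  have h4 := hCb c
  omega

/-- A value gained at one point of a balanced set is lost at another one. -/
lemma BalancedOn.exists_lost (hS : BalancedOn S f g) {h : ι} (hh : h ∈ S) (hfg : f h ≠ g h) :
    ∃ i ∈ S, f i = g h ∧ g i ≠ g h := by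
  by_contra! hcon
  have hsub : (S.filter fun i => f i = g h) ⊂ S.filter fun i => g i = g h := by
    rw [Finset.ssubset_iff_of_subset]
    · exact ⟨h, by simp [hh], by simp [hfg]⟩
    · intro i hi
      rw [Finset.mem_filter] at hi ⊢
      exact ⟨hi.1, hcon i hi.1 hi.2⟩
  exact (Finset.card_lt_card hsub).ne (hS _)

lemma BalancedOn.of_perm [Fintype ι] {f g : ι → Option Bool} (σ : Equiv.Perm ι)
    (hσ : ∀ i, g i = f (σ i)) : BalancedOn Finset.univ f g := by
  intro c
  refine (Finset.card_equiv σ fun i => ?_).symm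
  simp [hσ]

lemma BalancedOn.exists_perm [Fintype ι] {f g : ι → Option Bool}
    (h : BalancedOn Finset.univ f g) : ∃ σ : Equiv.Perm ι, ∀ i, g i = f (σ i) := by
  have e : ∀ c, Nonempty ({i // g i = c} ≃ {i // f i = c}) := fun c =>
    Fintype.card_eq.1 (by rw [Fintype.card_subtype, Fintype.card_subtype, h c])
  exact ⟨Equiv.ofFiberEquiv fun c => (e c).some, fun i => (Equiv.ofFiberEquiv_map _ i).symm⟩

lemma balanced_swap {h j : ι} (hh : h ∈ S) (hj : j ∈ S)
    (hg : ∀ i, g i = f (Equiv.swap h j i)) : BalancedOn S f g := by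
  intro c
  refine (Finset.card_equiv (Equiv.swap h j) fun i => ?_).symm
  simp only [Finset.mem_filter, hg]
  refine and_congr_left fun _ => ?_
  rcases eq_or_ne i h with rfl | h1
  · simp [hh, hj]
  rcases eq_or_ne i j with rfl | h2
  · simp [hh, hj]
  rw [Equiv.swap_apply_of_ne_of_ne h1 h2]

/-- Two disjoint finite sets of the same size are exchanged by a permutation fixing all
other points. -/
lemma exists_perm_exchange (A : Finset ι) : ∀ B : Finset ι, Disjoint A B → A.card = B.card →
    ∃ σ : Equiv.Perm ι, (∀ i ∈ A, σ i ∈ B) ∧ (∀ i ∈ B, σ i ∈ A) ∧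
      ∀ i, i ∉ A → i ∉ B → σ i = i := by
  induction A using Finset.induction_on with
  | empty =>
    intro B _ hB
    have : B = ∅ := Finset.card_eq_zero.1 hB.symm
    subst this
    exact ⟨1, by simp, by simp, by simp⟩
  | insert a A ha ih =>
    intro B hd hc
    rw [Finset.card_insert_of_notMem ha] at hc
    obtain ⟨b, hb⟩ : B.Nonempty := Finset.card_pos.1 (by omega)
    rw [Finset.disjoint_insert_left] at hd
    obtain ⟨σ, h1, h2, h3⟩ := ih (B.erase b)
      (hd.2.mono_right (Finset.erase_subset _ _)) (by rw [Finset.card_erase_of_mem hb]; omega)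
    have hbA : b ∉ A := fun h => Finset.disjoint_left.1 hd.2 h hb
    have hab : a ≠ b := fun h => hd.1 (h ▸ hb)
    have hσa : σ a = a := h3 a ha fun h => hd.1 (Finset.mem_of_mem_erase h)
    have hσb : σ b = b := h3 b hbA (Finset.notMem_erase _ _)
    refine ⟨Equiv.swap a b * σ, fun i hi => ?_, fun i hi => ?_, fun i hi hi' => ?_⟩
    · rcases Finset.mem_insert.1 hi with rfl | hi
      · simp [hσa, hb]
      · have := Finset.mem_erase.1 (h1 i hi)
        rw [Equiv.Perm.mul_apply, Equiv.swap_apply_of_ne_of_ne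
          (fun h => hd.1 (by rw [← h]; exact this.2)) this.1]
        exact this.2
    · rcases eq_or_ne i b with rfl | hib
      · simp [hσb]
      · have := h2 i (Finset.mem_erase.2 ⟨hib, hi⟩)
        rw [Equiv.Perm.mul_apply, Equiv.swap_apply_of_ne_of_ne
          (fun h => ha (by rw [← h]; exact this)) (fun h => hbA (by rw [← h]; exact this))]
        exact Finset.mem_insert_of_mem this
    · rw [Finset.mem_insert, not_or] at hi
      rw [Equiv.Perm.mul_apply, h3 i hi.2 (fun h => hi' (Finset.mem_of_mem_erase h)),
        Equiv.swap_apply_of_ne_of_ne hi.1 (fun h => hi' (h ▸ hb))]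

/-! ### Partial labellings -/

variable {x y z : ι → Option ℤ}

/-- `x` and `z` agree on the part of `S` where both are defined. -/
def Compat (S : Finset ι) (x z : ι → Option ℤ) : Prop :=
  ∀ i ∈ S, x i = none ∨ z i = none ∨ x i = z i

/-- `y` can be reached from `x` in `t` steps when only the points of `S` are considered: each
step leads to a compatible partial labelling with the same numbers of labels of each kind. -/
def Reach (S : Finset ι) : ℕ → (ι → Option ℤ) → (ι → Option ℤ) → Prop
  | 0, x, y => ∀ i ∈ S, x i = y i
  | t + 1, x, y => ∃ z, Compat S x z ∧ BalancedOn S (kind ∘ x) (kind ∘ z) ∧ Reach S t z y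

lemma Compat.refl (S : Finset ι) (x : ι → Option ℤ) : Compat S x x :=
  fun _ _ => Or.inr (Or.inr rfl)

lemma Reach.succ {t : ℕ} (h : Reach S t x y) : Reach S (t + 1) x y :=
  ⟨x, Compat.refl _ _, BalancedOn.refl _ _, h⟩

lemma Reach.mono {t t' : ℕ} (h : Reach S t x y) (ht : t ≤ t') : Reach S t' x y := by
  induction ht with
  | refl => exact h
  | step _ ih => exact ih.succ

lemma Reach.congr_left {t : ℕ} {x' : ι → Option ℤ} (h : Reach S t x y)
    (hx : ∀ i ∈ S, x i = x' i) : Reach S t x' y := by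
  cases t with
  | zero => exact fun i hi => (hx i hi).symm.trans (h i hi)
  | succ t =>
    obtain ⟨z, h1, h2, h3⟩ := h
    refine ⟨z, fun i hi => hx i hi ▸ h1 i hi, h2.congr (fun i hi => ?_) fun _ _ => rfl, h3⟩
    simp [hx i hi]

/-- Moves on the blocks of a partition can be carried out simultaneously. -/
lemma Reach.merge [Fintype ι] (b : ι → ι) {t : ℕ}
    (h : ∀ j, Reach (Finset.univ.filter fun i => b i = j) t x y) :
    Reach Finset.univ t x y := by
  induction t generalizing x with
  | zero => exact fun i _ => h (b i) i (by simp)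
  | succ t ih =>
    choose z h1 h2 h3 using h
    refine ⟨fun i => z (b i) i, fun i _ => h1 (b i) i (by simp), fun c => ?_, ih fun j => ?_⟩
    · rw [Finset.card_eq_sum_card_fiberwise (f := b) (t := Finset.univ) (by simp),
        Finset.card_eq_sum_card_fiberwise (f := b) (t := Finset.univ) (by simp)]
      refine Finset.sum_congr rfl fun j _ => ?_
      have h := h2 j c
      rw [Finset.filter_filter, Finset.filter_filter] at h
      rw [Finset.filter_filter, Finset.filter_filter,
        Finset.filter_congr (q := fun i => b i = j ∧ (kind ∘ x) i = c) fun i _ => and_comm, h]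
      refine congrArg _ (Finset.filter_congr fun i _ => ?_)
      constructor
      · rintro ⟨rfl, h'⟩
        exact ⟨h', rfl⟩
      · rintro ⟨h', rfl⟩
        exact ⟨rfl, h'⟩
    · refine (h3 j).congr_left fun i hi => ?_
      rw [(Finset.mem_filter.1 hi).2]

/-- Move the hole `h` to `j`, filling `h` with `o`. -/
def moveHole (x : ι → Option ℤ) (h j : ι) (o : Option ℤ) : ι → Option ℤ :=
  Function.update (Function.update x h o) j none

lemma moveHole_balanced {h j : ι} {o : Option ℤ} (hh : h ∈ S) (hj : j ∈ S) (hjh : j ≠ h)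
    (hx : x h = none) (ho : kind o = kind (x j)) :
    BalancedOn S (kind ∘ x) (kind ∘ moveHole x h j o) := by
  refine balanced_swap hh hj fun i => ?_
  rcases eq_or_ne i j with rfl | h1
  · simp [moveHole, hx]
  rcases eq_or_ne i h with rfl | h2
  · simp [moveHole, h1, ho]
  · simp [moveHole, h1, h2, Equiv.swap_apply_of_ne_of_ne]

lemma Reach.of_moveHole {h j : ι} {o : Option ℤ} {t : ℕ} (hh : h ∈ S) (hj : j ∈ S) (hjh : j ≠ h)
    (hx : x h = none) (ho : kind o = kind (x j)) (hr : Reach S t (moveHole x h j o) y) :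
    Reach S (t + 1) x y := by
  refine ⟨_, fun i _ => ?_, moveHole_balanced hh hj hjh hx ho, hr⟩
  rcases eq_or_ne i j with rfl | h1
  · simp [moveHole]
  rcases eq_or_ne i h with rfl | h2
  · simp [hx]
  · simp [moveHole, h1, h2]

lemma moveHole_eq_none {h j i : ι} {o : Option ℤ} (hjh : j ≠ h)
    (hx : x i = none ↔ i = h) (ho : o ≠ none) : moveHole x h j o i = none ↔ i = j := by
  rcases eq_or_ne i j with rfl | h1
  · simp [moveHole]
  rcases eq_or_ne i h with rfl | h2
  · simp [moveHole, h1, ho]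
  · simp [moveHole, h1, h2, hx]

/-- The points of `S` where `x` and `y` differ. -/
def diffSet (S : Finset ι) (x y : ι → Option ℤ) : Finset ι := S.filter fun i => x i ≠ y i

lemma mem_diffSet_of_left {h : ι} (hh : h ∈ S) (hx : x h = none) (hy : y h ≠ none) :
    h ∈ diffSet S x y :=
  Finset.mem_filter.2 ⟨hh, fun he => hy (he ▸ hx)⟩

lemma mem_diffSet_of_right {h : ι} (hh : h ∈ S) (hx : x h ≠ none) (hy : y h = none) :
    h ∈ diffSet S x y :=
  Finset.mem_filter.2 ⟨hh, fun he => hx (he ▸ hy)⟩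

lemma diffSet_moveHole_subset {h j : ι} (hj : j ∈ diffSet S x y) (hjh : j ≠ h) :
    diffSet S (moveHole x h j (y h)) y ⊆ (diffSet S x y).erase h := by
  intro i hi
  simp only [diffSet, Finset.mem_filter, Finset.mem_erase] at hi hj ⊢
  rcases eq_or_ne i j with rfl | h1
  · exact ⟨hjh, hj⟩
  rcases eq_or_ne i h with rfl | h2
  · simp [moveHole, h1] at hi
  · simpa [moveHole, h1, h2] using hi

lemma diffSet_moveHole_subset_insert {h j : ι} {o : Option ℤ} (hj : j ∈ diffSet S x y) :
    diffSet S (moveHole x h j o) y ⊆ insert h (diffSet S x y) := by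
  intro i hi
  simp only [diffSet, Finset.mem_filter, Finset.mem_insert] at hi hj ⊢
  rcases eq_or_ne i j with rfl | h1
  · exact Or.inr hj
  rcases eq_or_ne i h with rfl | h2
  · exact Or.inl rfl
  · simpa [moveHole, h1, h2] using hi

/-- A single hole has to travel from `h` to `h'`, and all labels to be changed are of the
same kind. -/
lemma reach_open_of_kind {c : Bool} {h' : ι} (hh' : h' ∈ S)
    (hy : ∀ i ∈ S, y i = none ↔ i = h') (t : ℕ) : ∀ (x : ι → Option ℤ) (h : ι), h ∈ S → h ≠ h' →
    (∀ i ∈ S, x i = none ↔ i = h) → BalancedOn S (kind ∘ x) (kind ∘ y) →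
    (∀ i ∈ diffSet S x y, i ≠ h → kind (x i) = some c) → (diffSet S x y).card ≤ t + 1 →
    Reach S t x y := by
  induction t with
  | zero =>
    intro x h hh hne hx _ _ hcard
    have h1 := mem_diffSet_of_left hh ((hx h hh).2 rfl) (mt (hy h hh).1 hne)
    have h2 := mem_diffSet_of_right hh' (mt (hx h' hh').1 hne.symm) ((hy h' hh').2 rfl)
    exact absurd (Finset.card_le_one.1 hcard h h1 h' h2) hne
  | succ t ih =>
    intro x h hh hne hx hb hc hcard
    have hxh : x h = none := (hx h hh).2 rfl
    have hyh : y h ≠ none := mt (hy h hh).1 hne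
    have h1 := mem_diffSet_of_left hh hxh hyh
    have h2 := mem_diffSet_of_right hh' (mt (hx h' hh').1 hne.symm) ((hy h' hh').2 rfl)
    have hkc : kind (y h) = some c := by
      obtain ⟨i, hi, hi1, hi2⟩ := hb.exists_lost hh
        (by simpa [hxh, eq_comm, kind_eq_none] using hyh)
      simp only [Function.comp] at hi1 hi2
      rw [← hi1]
      refine hc i (Finset.mem_filter.2 ⟨hi, fun he => hi2 (he ▸ hi1)⟩) ?_
      rintro rfl
      rw [hxh, kind_none] at hi1
      exact hyh (kind_eq_none.1 hi1.symm)
    by_cases hj : ∃ j ∈ diffSet S x y, j ≠ h ∧ j ≠ h'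
    · obtain ⟨j, hj, hjh, hjh'⟩ := hj
      have hjS := (Finset.mem_filter.1 hj).1
      have hk : kind (y h) = kind (x j) := hkc.trans (hc j hj hjh).symm
      have hsub := diffSet_moveHole_subset hj hjh
      refine Reach.of_moveHole hh hjS hjh hxh hk (ih _ j hjS hjh' (fun i hi =>
        moveHole_eq_none hjh (hx i hi) hyh) ((moveHole_balanced hh hjS hjh hxh hk).symm.trans hb)
        (fun i hi hij => ?_) ?_)
      · have := Finset.mem_erase.1 (hsub hi)
        rw [moveHole, Function.update_of_ne hij, Function.update_of_ne this.1]
        exact hc i this.2 this.1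
      · have := Finset.card_le_card hsub
        rw [Finset.card_erase_of_mem h1] at this
        omega
    · push Not at hj
      refine Reach.of_moveHole hh hh' hne.symm hxh (hkc.trans (hc h' h2 hne.symm).symm)
        (Reach.mono (t := 0) (fun i hi => ?_) (Nat.zero_le t))
      rcases eq_or_ne i h' with rfl | hi'
      · simp [moveHole, (hy i hi).2 rfl]
      rcases eq_or_ne i h with rfl | hi2
      · simp [moveHole, hi']
      · by_contra hcon
        rw [moveHole, Function.update_of_ne hi', Function.update_of_ne hi2] at hcon
        exact hi' (hj i (Finset.mem_filter.2 ⟨hi, hcon⟩) hi2)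

/-- A single hole `h` that has to return to its position, all labels to be changed being of
the same kind. -/
lemma reach_closed_of_kind {c : Bool} {h : ι} (hh : h ∈ S)
    (hy : ∀ i ∈ S, y i = none ↔ i = h) (hx : ∀ i ∈ S, x i = none ↔ i = h)
    (hb : BalancedOn S (kind ∘ x) (kind ∘ y)) (hc : ∀ i ∈ diffSet S x y, kind (x i) = some c) :
    Reach S ((diffSet S x y).card + 1) x y := by
  rcases (diffSet S x y).eq_empty_or_nonempty with he | ⟨j, hj⟩
  · refine Reach.mono (t := 0) (fun i hi => ?_) (Nat.zero_le _)
    by_contra hcon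
    exact Finset.notMem_empty i (he ▸ Finset.mem_filter.2 ⟨hi, hcon⟩)
  have hjS := (Finset.mem_filter.1 hj).1
  have hxh := (hx h hh).2 rfl
  have hyh := (hy h hh).2 rfl
  have hjh : j ≠ h := by
    rintro rfl
    exact (Finset.mem_filter.1 hj).2 (hxh.trans hyh.symm)
  have hxj : x j ≠ none := mt (hx j hjS).1 hjh
  have hsub := diffSet_moveHole_subset_insert (h := h) (o := x j) hj
  refine Reach.of_moveHole hh hjS hjh hxh rfl (reach_open_of_kind (c := c) hh hy _ _ j hjS hjh
    (fun i hi => moveHole_eq_none hjh (hx i hi) hxj)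
    ((moveHole_balanced hh hjS hjh hxh rfl).symm.trans hb) (fun i hi hij => ?_)
    ((Finset.card_le_card hsub).trans (Finset.card_insert_le _ _)))
  rcases eq_or_ne i h with rfl | hih
  · simpa [moveHole, hij] using hc j hj
  · rw [moveHole, Function.update_of_ne hij, Function.update_of_ne hih]
    exact hc i (Finset.mem_of_mem_insert_of_ne (hsub hi) hih)

/-- A single hole has to travel from `h` to a different point `h'`. -/
lemma reach_open {h' : ι} (hh' : h' ∈ S)
    (hy : ∀ i ∈ S, y i = none ↔ i = h') (t : ℕ) : ∀ (x : ι → Option ℤ) (h : ι), h ∈ S → h ≠ h' →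
    (∀ i ∈ S, x i = none ↔ i = h) → BalancedOn S (kind ∘ x) (kind ∘ y) →
    (diffSet S x y).card ≤ t → Reach S t x y := by
  induction t with
  | zero =>
    intro x h hh hne hx _ hcard i hi
    by_contra hcon
    have : 0 < (diffSet S x y).card := Finset.card_pos.2 ⟨i, Finset.mem_filter.2 ⟨hi, hcon⟩⟩
    exact absurd hcard (not_le.2 this)
  | succ t ih =>
    intro x h hh hne hx hb hcard
    have hxh : x h = none := (hx h hh).2 rfl
    have hyh : y h ≠ none := mt (hy h hh).1 hne
    have h1 := mem_diffSet_of_left hh hxh hyh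
    have h2 := mem_diffSet_of_right hh' (mt (hx h' hh').1 hne.symm) ((hy h' hh').2 rfl)
    obtain ⟨i₀, hi₀, hi1, hi2⟩ := hb.exists_lost hh
      (by simpa [hxh, eq_comm, kind_eq_none] using hyh)
    simp only [Function.comp] at hi1 hi2
    have hi₀h : i₀ ≠ h := by
      rintro rfl
      rw [hxh, kind_none] at hi1
      exact hyh (kind_eq_none.1 hi1.symm)
    have hi₀d : i₀ ∈ diffSet S x y := Finset.mem_filter.2 ⟨hi₀, fun he => hi2 (he ▸ hi1)⟩
    by_cases hj : ∃ j ∈ diffSet S x y, j ≠ h' ∧ kind (x j) = kind (y h)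
    · obtain ⟨j, hj, hjh', hk⟩ := hj
      have hjh : j ≠ h := by
        rintro rfl
        rw [hxh, kind_none] at hk
        exact hyh (kind_eq_none.1 hk.symm)
      have hjS := (Finset.mem_filter.1 hj).1
      have hsub := diffSet_moveHole_subset hj hjh
      refine Reach.of_moveHole hh hjS hjh hxh hk.symm (ih _ j hjS hjh' (fun i hi =>
        moveHole_eq_none hjh (hx i hi) hyh)
        ((moveHole_balanced hh hjS hjh hxh hk.symm).symm.trans hb) ?_)
      have := Finset.card_le_card hsub
      rw [Finset.card_erase_of_mem h1] at this
      omega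
    · push Not at hj
      have hi₀' : i₀ = h' := by
        by_contra hcon
        exact hj i₀ hi₀d hcon hi1
      subst hi₀'
      obtain ⟨c, hc⟩ := Option.ne_none_iff_exists'.1 (mt kind_eq_none.1 hyh)
      have hsub := diffSet_moveHole_subset hi₀d hi₀h
      have hsub' : diffSet S (moveHole x h i₀ (y h)) y ⊆ ((diffSet S x y).erase h).erase i₀ := by
        intro i hi
        refine Finset.mem_erase.2 ⟨?_, hsub hi⟩
        rintro rfl
        exact (Finset.mem_filter.1 hi).2 (by simp [moveHole, (hy i hh').2 rfl])
      have hcd := Finset.card_le_card hsub'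
      rw [Finset.card_erase_of_mem (Finset.mem_erase.2 ⟨hi₀h, hi₀d⟩),
        Finset.card_erase_of_mem h1] at hcd
      have hone : 1 < (diffSet S x y).card := Finset.one_lt_card.2 ⟨h, h1, i₀, h2, hne⟩
      refine Reach.of_moveHole hh hi₀ hi₀h hxh hi1.symm
        (Reach.mono (reach_closed_of_kind (c := !c) hi₀ hy (fun i hi =>
        moveHole_eq_none hi₀h (hx i hi) hyh)
        ((moveHole_balanced hh hi₀ hi₀h hxh hi1.symm).symm.trans hb) fun i hi => ?_) (by omega))
      have hi' := Finset.mem_erase.1 (hsub' hi)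
      have hi'' := Finset.mem_erase.1 hi'.2
      have hiS := (Finset.mem_filter.1 hi).1
      have hxi : x i ≠ none := mt (hx i hiS).1 hi''.1
      have hk := hj i hi''.2 hi'.1
      rw [moveHole, Function.update_of_ne hi'.1, Function.update_of_ne hi''.1]
      obtain ⟨d, hd⟩ := Option.ne_none_iff_exists'.1 (mt kind_eq_none.1 hxi)
      rw [hd, hc] at hk
      rw [hd, Bool.eq_not.2 fun h => hk (congrArg _ h)]

/-- A single hole `h` that has to return to its position. -/
lemma reach_closed {h : ι} (hh : h ∈ S)
    (hy : ∀ i ∈ S, y i = none ↔ i = h) (hx : ∀ i ∈ S, x i = none ↔ i = h)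
    (hb : BalancedOn S (kind ∘ x) (kind ∘ y)) :
    Reach S ((diffSet S x y).card + 2) x y := by
  rcases (diffSet S x y).eq_empty_or_nonempty with he | ⟨j, hj⟩
  · refine Reach.mono (t := 0) (fun i hi => ?_) (Nat.zero_le _)
    by_contra hcon
    exact Finset.notMem_empty i (he ▸ Finset.mem_filter.2 ⟨hi, hcon⟩)
  have hjS := (Finset.mem_filter.1 hj).1
  have hxh := (hx h hh).2 rfl
  have hyh := (hy h hh).2 rfl
  have hjh : j ≠ h := by
    rintro rfl
    exact (Finset.mem_filter.1 hj).2 (hxh.trans hyh.symm)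
  have hxj : x j ≠ none := mt (hx j hjS).1 hjh
  have hsub := diffSet_moveHole_subset_insert (h := h) (o := x j) hj
  exact Reach.of_moveHole hh hjS hjh hxh rfl (reach_open hh hy _ _ j hjS hjh
    (fun i hi => moveHole_eq_none hjh (hx i hi) hxj)
    ((moveHole_balanced hh hjS hjh hxh rfl).symm.trans hb)
    ((Finset.card_le_card hsub).trans (Finset.card_insert_le _ _)))

/-! ### Packing balanced cycles into blocks with a single hole -/

/-- The points of `S` where both `f` and `g` are defined. -/
def loadSet (S : Finset ι) (f g : ι → Option Bool) : Finset ι :=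
  S.filter fun i => f i ≠ none ∧ g i ≠ none

/-- `b` divides `S` into balanced blocks indexed by the holes of `f`, each containing at most
`M` points where both `f` and `g` are defined. -/
structure Packing (S : Finset ι) (f g : ι → Option Bool) (b : ι → ι) (M : ℕ) : Prop where
  mem : ∀ i ∈ S, b i ∈ S ∧ f (b i) = none
  fix : ∀ i ∈ S, f i = none → b i = i
  bal : ∀ h ∈ S, f h = none → BalancedOn (S.filter fun i => b i = h) f g
  load : ∀ h ∈ S, f h = none → (loadSet (S.filter fun i => b i = h) f g).card ≤ M

lemma Packing.mono {b : ι → ι} {M M' : ℕ} (h : Packing S f g b M) (hM : M ≤ M') :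
    Packing S f g b M' :=
  ⟨h.mem, h.fix, h.bal, fun j hj hj' => (h.load j hj hj').trans hM⟩

lemma balancedOn_singleton {a : ι} (h : f a = g a) : BalancedOn {a} f g := by
  intro c
  simp [Finset.filter_singleton, h]

lemma balancedOn_pair {a b : ι} (hab : a ≠ b) (h1 : f a = g b) (h2 : f b = g a) :
    BalancedOn {a, b} f g := by
  intro c
  simp only [Finset.card_filter]
  rw [Finset.sum_pair hab, Finset.sum_pair hab, h1, h2, add_comm]

lemma balancedOn_triple {a b d : ι} (hab : a ≠ b) (had : a ≠ d) (hbd : b ≠ d) (h1 : f a = g b)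
    (h2 : f b = g d) (h3 : f d = g a) : BalancedOn {a, b, d} f g := by
  intro c
  have key : ∀ k : ι → Option Bool, (({a, b, d} : Finset ι).filter fun i => k i = c).card =
      (if k a = c then 1 else 0) + ((if k b = c then 1 else 0) + if k d = c then 1 else 0) := by
    intro k
    rw [Finset.card_filter, Finset.sum_insert (by simp [hab, had]), Finset.sum_pair hbd]
  rw [key, key, h1, h2, h3]
  ring

lemma BalancedOn.exists_cycle_of_hole (hS : BalancedOn S f g) {h : ι} (hh : h ∈ S)
    (hf : f h = none) : ∃ C ⊆ S, BalancedOn C f g ∧ h ∈ C ∧ (∀ i ∈ C, f i = none → i = h) ∧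
      (loadSet C f g).card ≤ 1 := by
  by_cases hg : g h = none
  · refine ⟨{h}, by simpa, balancedOn_singleton (hf.trans hg.symm), by simp, by simp, ?_⟩
    exact (Finset.card_filter_le _ _).trans (by simp)
  by_cases h2 : ∃ j ∈ S, g j = none ∧ f j = g h
  · obtain ⟨j, hj, hgj, hfj⟩ := h2
    have hne : h ≠ j := by
      rintro rfl
      exact hg hgj
    refine ⟨{h, j}, by simp [Finset.insert_subset_iff, hh, hj],
      balancedOn_pair hne (hf.trans hgj.symm) hfj, by simp, ?_, ?_⟩
    · simp only [Finset.mem_insert, Finset.mem_singleton]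
      rintro i (rfl | rfl) hi
      · rfl
      · exact absurd (hfj.symm.trans hi) hg
    · simp [loadSet, Finset.filter_insert, Finset.filter_singleton, hf, hgj]
  · push Not at h2
    obtain ⟨j, hj, hgj, hfj⟩ := hS.symm.exists_lost hh fun h => hg (h.trans hf)
    rw [hf] at hgj hfj
    obtain ⟨i, hi, hfi, hgi⟩ := hS.exists_lost hh fun h => hg (h.symm.trans hf)
    have hfjh := h2 j hj hgj
    have hgin : g i ≠ none := fun h => h2 i hi h hfi
    have hij : f j = g i := by
      revert hfjh hfj hgi hgin hg
      generalize f j = u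
      generalize g h = v
      generalize g i = w
      revert u v w
      decide
    have h1 : h ≠ j := by
      rintro rfl
      exact hg hgj
    have h3 : h ≠ i := by
      rintro rfl
      exact hg (hfi.symm.trans hf)
    have h4 : j ≠ i := by
      rintro rfl
      exact hgin hgj
    refine ⟨{h, j, i}, by simp [Finset.insert_subset_iff, hh, hj, hi],
      balancedOn_triple h1 h3 h4 (hf.trans hgj.symm) hij hfi, by simp, ?_, ?_⟩
    · simp only [Finset.mem_insert, Finset.mem_singleton]
      rintro k (rfl | rfl | rfl) hk
      · rfl
      · exact absurd hk hfj
      · exact absurd (hfi.symm.trans hk) hg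
    · simp only [loadSet, Finset.filter_insert, Finset.filter_singleton, hf, hgj]
      simp
      split_ifs <;> simp

/-- Blocks with load at most one, covering all holes of `f`. -/
lemma BalancedOn.exists_packing_holes (S : Finset ι) : BalancedOn S f g →
    ∃ R ⊆ S, ∃ b, Packing R f g b 1 ∧ BalancedOn R f g ∧ ∀ i ∈ S, f i = none → i ∈ R := by
  induction S using Finset.strongInduction with
  | H S ih =>
    intro hS
    by_cases hh : ∃ h ∈ S, f h = none
    · obtain ⟨h, hh, hf⟩ := hh
      obtain ⟨C, hCS, hC, hhC, hu, hl⟩ := hS.exists_cycle_of_hole hh hf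
      obtain ⟨R, hR, b, hb, hRb, hcov⟩ := ih (S \ C)
        (Finset.sdiff_ssubset hCS ⟨h, hhC⟩) (hS.sdiff hCS hC)
      have hd : Disjoint C R := Finset.disjoint_sdiff.mono_right hR
      have hRC : ∀ i ∈ R, i ∉ C := fun i hi hi' => Finset.disjoint_left.1 hd hi' hi
      have hf1 : ((C ∪ R).filter fun i => (if i ∈ C then h else b i) = h) = C := by
        ext i
        simp only [Finset.mem_filter, Finset.mem_union]
        constructor
        · rintro ⟨hi | hi, hi'⟩
          · exact hi
          · rw [if_neg (hRC i hi)] at hi'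
            exact absurd (hi' ▸ hhC) (hRC _ (hb.mem i hi).1)
        · intro hi
          simp [hi]
      have hf2 : ∀ j ∈ R, ((C ∪ R).filter fun i => (if i ∈ C then h else b i) = j) =
          R.filter fun i => b i = j := by
        intro j hj
        ext i
        simp only [Finset.mem_filter, Finset.mem_union]
        constructor
        · rintro ⟨hi | hi, hi'⟩
          · rw [if_pos hi] at hi'
            exact absurd (hi' ▸ hhC) (hRC j hj)
          · rw [if_neg (hRC i hi)] at hi'
            exact ⟨hi, hi'⟩
        · rintro ⟨hi, hi'⟩
          exact ⟨Or.inr hi, by rwa [if_neg (hRC i hi)]⟩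
      refine ⟨C ∪ R, Finset.union_subset hCS (hR.trans Finset.sdiff_subset),
        fun i => if i ∈ C then h else b i, ⟨fun i hi => ?_, fun i hi hfi => ?_,
        fun j hj hfj => ?_, fun j hj hfj => ?_⟩, hC.union hd hRb, fun i hi hfi => ?_⟩
      · rw [Finset.mem_union] at hi ⊢
        by_cases hiC : i ∈ C
        · simp [hiC, hf, hhC]
        · have := hb.mem i (hi.resolve_left hiC)
          simp [hiC, this]
      · by_cases hiC : i ∈ C
        · exact (if_pos hiC).trans (hu i hiC hfi).symm
        · simp [hiC, hb.fix i ((Finset.mem_union.1 hi).resolve_left hiC) hfi]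
      · rcases Finset.mem_union.1 hj with hj | hj
        · obtain rfl := hu j hj hfj
          rw [hf1]
          exact hC
        · rw [hf2 j hj]
          exact hb.bal j hj hfj
      · rcases Finset.mem_union.1 hj with hj | hj
        · obtain rfl := hu j hj hfj
          rw [hf1]
          exact hl
        · rw [hf2 j hj]
          exact hb.load j hj hfj
      · by_cases hiC : i ∈ C
        · exact Finset.mem_union_left _ hiC
        · exact Finset.mem_union_right _ (hcov i (Finset.mem_sdiff.2 ⟨hi, hiC⟩) hfi)
    · push Not at hh
      exact ⟨∅, by simp, id, ⟨by simp, by simp, by simp, by simp⟩, fun c => by simp,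
        fun i hi h => absurd h (hh i hi)⟩

/-- A nonempty balanced set without holes contains a balanced set with one or two points. -/
lemma BalancedOn.exists_cycle (hT : BalancedOn T f g) (hf : ∀ i ∈ T, f i ≠ none)
    (hg : ∀ i ∈ T, g i ≠ none) (hne : T.Nonempty) :
    ∃ C ⊆ T, C.Nonempty ∧ BalancedOn C f g ∧
      (C.card ≤ 1 ∨ C.card ≤ 2 ∧ ∃ i ∈ T, f i ≠ g i) := by
  obtain ⟨a, ha⟩ := hne
  by_cases h : f a = g a
  · exact ⟨{a}, by simpa, by simp, balancedOn_singleton h, by simp⟩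
  · obtain ⟨i, hi, hfi, hgi⟩ := hT.exists_lost ha h
    have hia : f a = g i := by
      have h1 := hf a ha
      have h2 := hg a ha
      have h3 := hg i hi
      revert h1 h2 h3 h hgi
      generalize f a = u
      generalize g a = v
      generalize g i = w
      revert u v w
      decide
    have hne : a ≠ i := by
      rintro rfl
      exact h hfi
    refine ⟨{a, i}, by simp [Finset.insert_subset_iff, ha, hi], by simp,
      balancedOn_pair hne hia hfi, Or.inr ⟨Finset.card_le_two, a, ha, h⟩⟩

/-- In a packing with small total load some block has load less than `q`. -/
lemma Packing.exists_load_lt {b : ι → ι} {M q : ℕ} (h : Packing S f g b M)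
    (hq : (loadSet S f g).card < q * (S.filter fun i => f i = none).card) :
    ∃ j ∈ S, f j = none ∧ (loadSet (S.filter fun i => b i = j) f g).card < q := by
  by_contra! hcon
  rw [Finset.card_eq_sum_card_fiberwise (f := b) (t := S.filter fun i => f i = none)] at hq
  · refine absurd hq (not_lt.2 ?_)
    rw [mul_comm, ← smul_eq_mul]
    refine Finset.card_nsmul_le_sum _ _ _ fun j hj => ?_
    rw [Finset.mem_filter] at hj
    have := hcon j hj.1 hj.2
    rwa [loadSet, Finset.filter_filter, Finset.filter_congr fun i _ => and_comm,
      ← Finset.filter_filter] at this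
  · intro i hi
    have := h.mem i (Finset.mem_filter.1 hi).1
    simpa using this

lemma loadSet_union (S T : Finset ι) (f g : ι → Option Bool) :
    loadSet (S ∪ T) f g = loadSet S f g ∪ loadSet T f g :=
  Finset.filter_union _ _ _

lemma Packing.extend {R : Finset ι} {q M : ℕ} (hqM : q ≤ M) (T : Finset ι) :
    Disjoint R T → BalancedOn T f g → (∀ i ∈ T, f i ≠ none) → (∀ i ∈ T, g i ≠ none) →
    (q + 1 ≤ M ∨ ∀ i ∈ T, f i = g i) → (∃ b, Packing R f g b M) →
    (loadSet R f g).card + T.card ≤ q * (R.filter fun i => f i = none).card →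
    ∃ b, Packing (R ∪ T) f g b M := by
  induction T using Finset.strongInduction with
  | H T ih =>
    intro hd hT hf hg hM hR hq
    rcases T.eq_empty_or_nonempty with rfl | hne
    · simpa using hR
    obtain ⟨C, hCT, hCne, hC, hCc⟩ := hT.exists_cycle hf hg hne
    have hsub : T \ C ⊆ T := Finset.sdiff_subset
    have hcard := Finset.card_sdiff_add_card_eq_card hCT
    have hCpos := Finset.card_pos.2 hCne
    obtain ⟨b, hb⟩ := ih (T \ C) (Finset.sdiff_ssubset hCT hCne) (hd.mono_right hsub)
      (hT.sdiff hCT hC) (fun i hi => hf i (hsub hi)) (fun i hi => hg i (hsub hi))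
      (hM.imp_right fun h i hi => h i (hsub hi)) hR (by omega)
    set Q := R ∪ T \ C with hQ
    have hQC : Disjoint Q C :=
      Finset.disjoint_union_left.2 ⟨hd.mono_right hCT, Finset.sdiff_disjoint⟩
    have hQC' : ∀ i ∈ Q, i ∉ C := fun i hi hi' => Finset.disjoint_left.1 hQC hi hi'
    have hunion : R ∪ T = Q ∪ C := by
      rw [hQ, Finset.union_assoc, Finset.sdiff_union_of_subset hCT]
    have hload : (loadSet Q f g).card < q * (Q.filter fun i => f i = none).card := by
      have h1 : (loadSet Q f g).card ≤ (loadSet R f g).card + (T \ C).card := by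
        rw [hQ, loadSet_union]
        exact (Finset.card_union_le _ _).trans (Nat.add_le_add_left (Finset.card_filter_le _ _) _)
      have h2 : (R.filter fun i => f i = none).card ≤ (Q.filter fun i => f i = none).card :=
        Finset.card_le_card (Finset.filter_subset_filter _ Finset.subset_union_left)
      have h3 := Nat.mul_le_mul_left q h2
      omega
    obtain ⟨j, hj, hfj, hjl⟩ := hb.exists_load_lt hload
    have hfC : ∀ i ∈ C, f i ≠ none := fun i hi => hf i (hCT hi)
    have hf1 : ((Q ∪ C).filter fun i => (if i ∈ C then j else b i) = j) =
        (Q.filter fun i => b i = j) ∪ C := by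
      ext i
      simp only [Finset.mem_filter, Finset.mem_union]
      by_cases hi : i ∈ C <;> simp [hi]
    have hf2 : ∀ k ≠ j, ((Q ∪ C).filter fun i => (if i ∈ C then j else b i) = k) =
        Q.filter fun i => b i = k := by
      intro k hk
      ext i
      simp only [Finset.mem_filter, Finset.mem_union]
      by_cases hi : i ∈ C
      · have : i ∉ Q := fun h => hQC' i h hi
        simp [hi, hk.symm, this]
      · simp [hi]
    have hmemQ : ∀ i ∈ Q ∪ C, i ∉ C → i ∈ Q := fun i hi hi' =>
      (Finset.mem_union.1 hi).resolve_right hi'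
    rw [hunion]
    refine ⟨fun i => if i ∈ C then j else b i, fun i hi => ?_, fun i hi hfi => ?_,
      fun k hk hfk => ?_, fun k hk hfk => ?_⟩
    · by_cases hiC : i ∈ C
      · simp [hiC, hj, hfj]
      · have := hb.mem i (hmemQ i hi hiC)
        simp [hiC, this]
    · have hiC : i ∉ C := fun h => hfC i h hfi
      simp [hiC, hb.fix i (hmemQ i hi hiC) hfi]
    · have hkQ := hmemQ k hk fun h => hfC k h hfk
      rcases eq_or_ne k j with rfl | hkj
      · rw [hf1]
        exact (hb.bal k hkQ hfk).union (hQC.mono_left (Finset.filter_subset _ _)) hC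
      · rw [hf2 k hkj]
        exact hb.bal k hkQ hfk
    · have hkQ := hmemQ k hk fun h => hfC k h hfk
      rcases eq_or_ne k j with rfl | hkj
      · rw [hf1, loadSet_union]
        refine (Finset.card_union_le _ _).trans ?_
        have h1 : (loadSet C f g).card ≤ C.card := Finset.card_filter_le _ _
        rcases hCc with h | ⟨h, i, hi, hfg⟩
        · omega
        · have := hM.resolve_right fun hM => hfg (hM i hi)
          omega
      · rw [hf2 k hkj]
        exact hb.load k hkQ hfk

/-- Existence of a packing when the total load is at most `q` times the number of holes. -/
lemma BalancedOn.exists_packing {q M : ℕ} (hS : BalancedOn S f g) (hM1 : 1 ≤ M) (hqM : q ≤ M)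
    (hM : q + 1 ≤ M ∨ ∀ i ∈ S, f i ≠ none → g i ≠ none → f i = g i)
    (hq : (loadSet S f g).card ≤ q * (S.filter fun i => f i = none).card) :
    ∃ b, Packing S f g b M := by
  obtain ⟨R, hRS, b, hb, hR, hcov⟩ := hS.exists_packing_holes
  have hT := hS.sdiff hRS hR
  have hf : ∀ i ∈ S \ R, f i ≠ none := fun i hi h =>
    (Finset.mem_sdiff.1 hi).2 (hcov i (Finset.mem_sdiff.1 hi).1 h)
  have hg : ∀ i ∈ S \ R, g i ≠ none := by
    intro i hi h
    obtain ⟨k, hk, hk', -⟩ := hT.symm.exists_lost (h := i) hi fun h' => hf i hi (h'.symm.trans h)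
    have h0 := hT none
    rw [Finset.filter_false_of_mem hf, Finset.card_empty, eq_comm, Finset.card_eq_zero] at h0
    exact Finset.notMem_empty i (h0 ▸ Finset.mem_filter.2 ⟨hi, h⟩)
  rw [← Finset.union_sdiff_of_subset hRS]
  refine Packing.extend hqM (S \ R) Finset.disjoint_sdiff hT hf hg
    (hM.imp_right fun h i hi => h i (Finset.mem_sdiff.1 hi).1 (hf i hi) (hg i hi))
    ⟨b, hb.mono hM1⟩ ?_
  have h1 : (R.filter fun i => f i = none) = S.filter fun i => f i = none := by
    refine Finset.Subset.antisymm (Finset.filter_subset_filter _ hRS) fun i hi => ?_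
    rw [Finset.mem_filter] at hi ⊢
    exact ⟨hcov i hi.1 hi.2, hi.2⟩
  have h2 : loadSet S f g = loadSet R f g ∪ S \ R := by
    conv_lhs => rw [← Finset.union_sdiff_of_subset hRS, loadSet_union]
    congr 1
    exact Finset.filter_true_of_mem fun i hi => ⟨hf i hi, hg i hi⟩
  rw [h1]
  have hd : Disjoint (loadSet R f g) (S \ R) :=
    Finset.disjoint_sdiff.mono_left (Finset.filter_subset _ _)
  rwa [h2, Finset.card_union_of_disjoint hd] at hq

/-! ### Upper bounds -/

lemma BalancedOn.exists_hole (hb : BalancedOn S (kind ∘ x) (kind ∘ y)) {h : ι} (hh : h ∈ S)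
    (hx : ∀ i ∈ S, x i = none ↔ i = h) : ∃ h' ∈ S, ∀ i ∈ S, y i = none ↔ i = h' := by
  have h1 : (S.filter fun i => (kind ∘ x) i = none) = {h} := by
    ext i
    simp only [Function.comp, kind_eq_none, Finset.mem_filter, Finset.mem_singleton]
    exact ⟨fun hi => (hx i hi.1).1 hi.2, fun hi => hi ▸ ⟨hh, (hx h hh).2 rfl⟩⟩
  have h2 := hb none
  rw [h1, Finset.card_singleton, eq_comm, Finset.card_eq_one] at h2
  obtain ⟨h', h2⟩ := h2
  simp only [Finset.ext_iff, Function.comp, kind_eq_none, Finset.mem_filter,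
    Finset.mem_singleton] at h2
  exact ⟨h', ((h2 h').2 rfl).1, fun i hi => by rw [← h2 i]; simp [hi]⟩

lemma diffSet_subset_loadSet {h h' : ι} (hx : ∀ i ∈ S, x i = none ↔ i = h)
    (hy : ∀ i ∈ S, y i = none ↔ i = h') :
    diffSet S x y ⊆ insert h (insert h' (loadSet S (kind ∘ x) (kind ∘ y))) := by
  intro i hi
  have hiS := (Finset.mem_filter.1 hi).1
  simp only [Finset.mem_insert, loadSet, Finset.mem_filter, Function.comp, ne_eq, kind_eq_none,
    hx i hiS, hy i hiS]
  tauto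

lemma diffSet_subset_loadSet_of_closed {h : ι} (hx : ∀ i ∈ S, x i = none ↔ i = h)
    (hy : ∀ i ∈ S, y i = none ↔ i = h) :
    diffSet S x y ⊆ loadSet S (kind ∘ x) (kind ∘ y) := by
  intro i hi
  have hiS := (Finset.mem_filter.1 hi).1
  have hne : i ≠ h := by
    rintro rfl
    exact (Finset.mem_filter.1 hi).2 (((hx i hiS).2 rfl).trans ((hy i hiS).2 rfl).symm)
  simp only [loadSet, Finset.mem_filter, Function.comp, ne_eq, kind_eq_none, hx i hiS, hy i hiS]
  tauto

/-- The number of steps needed in a block with a single hole. -/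
lemma reach_block (hb : BalancedOn S (kind ∘ x) (kind ∘ y)) {h : ι} (hh : h ∈ S)
    (hx : ∀ i ∈ S, x i = none ↔ i = h) :
    Reach S ((loadSet S (kind ∘ x) (kind ∘ y)).card + 2) x y := by
  obtain ⟨h', hh', hy⟩ := hb.exists_hole hh hx
  rcases eq_or_ne h h' with rfl | hne
  · exact (reach_closed hh hy hx hb).mono
      (Nat.add_le_add_right (Finset.card_le_card (diffSet_subset_loadSet_of_closed hx hy)) 2)
  · refine reach_open hh' hy _ x h hh hne hx hb
      ((Finset.card_le_card (diffSet_subset_loadSet hx hy)).trans ?_)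
    exact (Finset.card_insert_le _ _).trans (Nat.succ_le_succ (Finset.card_insert_le _ _))

/-- The number of steps needed in a block with a single hole if all labels are of one kind. -/
lemma reach_block_of_kind (hb : BalancedOn S (kind ∘ x) (kind ∘ y)) {h : ι} (hh : h ∈ S)
    (hx : ∀ i ∈ S, x i = none ↔ i = h) {c : Bool}
    (hc : ∀ i ∈ S, x i ≠ none → kind (x i) = some c) :
    Reach S ((loadSet S (kind ∘ x) (kind ∘ y)).card + 1) x y := by
  obtain ⟨h', hh', hy⟩ := hb.exists_hole hh hx
  rcases eq_or_ne h h' with rfl | hne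
  · have hsub := diffSet_subset_loadSet_of_closed hx hy
    refine (reach_closed_of_kind (c := c) hh hy hx hb fun i hi => ?_).mono
      (Nat.add_le_add_right (Finset.card_le_card hsub) 1)
    have := Finset.mem_filter.1 (hsub hi)
    exact hc i this.1 (mt kind_eq_none.2 this.2.1)
  · refine reach_open_of_kind (c := c) hh' hy _ x h hh hne hx hb (fun i hi hih => ?_)
      ((Finset.card_le_card (diffSet_subset_loadSet hx hy)).trans ?_)
    · have hiS := (Finset.mem_filter.1 hi).1
      exact hc i hiS (mt (hx i hiS).1 hih)
    · exact (Finset.card_insert_le _ _).trans (Nat.succ_le_succ (Finset.card_insert_le _ _))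

variable [Fintype ι]

lemma Packing.reach_of_blocks {b : ι → ι} {M t : ℕ}
    (hP : Packing Finset.univ (kind ∘ x) (kind ∘ y) b M)
    (hr : ∀ (S : Finset ι) (h : ι), BalancedOn S (kind ∘ x) (kind ∘ y) → h ∈ S →
      (∀ i ∈ S, x i = none ↔ i = h) → (loadSet S (kind ∘ x) (kind ∘ y)).card ≤ M →
      Reach S t x y) : Reach Finset.univ t x y := by
  refine Reach.merge b fun j => ?_
  by_cases hj : x j = none
  · have hj' : (kind ∘ x) j = none := by simp [hj]
    refine hr _ j (hP.bal j (Finset.mem_univ j) hj') (by simp [hP.fix j (Finset.mem_univ j) hj'])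
      (fun i hi => ⟨fun h => ?_, fun h => h ▸ hj⟩) (hP.load j (Finset.mem_univ j) hj')
    rw [← hP.fix i (Finset.mem_univ i) (by simp [h])]
    exact (Finset.mem_filter.1 hi).2
  · have he : (Finset.univ.filter fun i => b i = j) = ∅ :=
      Finset.filter_false_of_mem fun i hi h =>
        hj (kind_eq_none.1 (h ▸ (hP.mem i hi).2))
    rw [he]
    exact Reach.mono (t := 0) (by simp [Reach]) (Nat.zero_le t)

lemma card_loadSet_le : (loadSet Finset.univ (kind ∘ x) (kind ∘ y)).card +
    (Finset.univ.filter fun i => x i = none).card ≤ Fintype.card ι := by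
  rw [← Finset.card_univ, ← Finset.card_union_of_disjoint]
  · exact Finset.card_le_card (Finset.subset_univ _)
  · rw [Finset.disjoint_left]
    intro i hi hi'
    simp only [loadSet, Finset.mem_filter, Function.comp, ne_eq, kind_eq_none] at hi hi'
    exact hi.2.1 hi'.2

lemma card_filter_kind_eq_none (S : Finset ι) (x : ι → Option ℤ) :
    (S.filter fun i => (kind ∘ x) i = none).card = (S.filter fun i => x i = none).card :=
  congrArg _ (Finset.filter_congr fun _ _ => kind_eq_none)

lemma reach_of_le_mul (hb : BalancedOn Finset.univ (kind ∘ x) (kind ∘ y)) {q : ℕ}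
    (hq : Fintype.card ι ≤ (q + 1) * (Finset.univ.filter fun i => x i = none).card) :
    Reach Finset.univ (q + 3) x y := by
  obtain ⟨b, hP⟩ := hb.exists_packing (q := q) (M := q + 1) (by omega) (by omega)
    (Or.inl le_rfl) (by
      have := card_loadSet_le (x := x) (y := y)
      rw [card_filter_kind_eq_none]
      rw [add_one_mul] at hq
      omega)
  exact hP.reach_of_blocks fun S h hS hh hx hl => (reach_block hS hh hx).mono (by omega)

lemma reach_of_le_mul_of_kind (hb : BalancedOn Finset.univ (kind ∘ x) (kind ∘ y)) {q : ℕ}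
    {c : Bool} (hx : ∀ i, x i ≠ none → kind (x i) = some c)
    (hy : ∀ i, y i ≠ none → kind (y i) = some c) (hq1 : 1 ≤ q)
    (hq : Fintype.card ι ≤ (q + 1) * (Finset.univ.filter fun i => x i = none).card) :
    Reach Finset.univ (q + 1) x y := by
  obtain ⟨b, hP⟩ := hb.exists_packing (q := q) (M := q) hq1 le_rfl
    (Or.inr fun i _ h1 h2 => (hx i (mt kind_eq_none.2 h1)).trans (hy i (mt kind_eq_none.2 h2)).symm)
    (by
      have := card_loadSet_le (x := x) (y := y)
      rw [card_filter_kind_eq_none]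
      rw [add_one_mul] at hq
      omega)
  exact hP.reach_of_blocks fun S h hS hh hxS hl =>
    (reach_block_of_kind hS hh hxS fun i _ => hx i).mono (by omega)

lemma reach_of_single_hole (hb : BalancedOn Finset.univ (kind ∘ x) (kind ∘ y)) {h : ι}
    (hx : ∀ i, x i = none ↔ i = h) : Reach Finset.univ (Fintype.card ι + 1) x y := by
  obtain ⟨h', -, hy⟩ := hb.exists_hole (Finset.mem_univ h) fun i _ => hx i
  rcases eq_or_ne h h' with rfl | hne
  · refine (reach_closed (Finset.mem_univ h) hy (fun i _ => hx i) hb).mono ?_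
    have : (diffSet Finset.univ x y).card < Fintype.card ι := by
      rw [← Finset.card_univ]
      refine Finset.card_lt_card (Finset.ssubset_univ_iff.2 fun he => ?_)
      have hmem : h ∈ diffSet Finset.univ x y := by
        rw [he]
        exact Finset.mem_univ h
      exact (Finset.mem_filter.1 hmem).2 (((hx h).2 rfl).trans ((hy h (Finset.mem_univ h)).2 rfl).symm)
    omega
  · exact (reach_open (Finset.mem_univ h') hy _ x h (Finset.mem_univ h) hne (fun i _ => hx i) hb
      (Finset.card_le_univ _)).succ

/-- If at most half of the points are labelled, two steps suffice. -/
lemma reach_two (hb : BalancedOn Finset.univ (kind ∘ x) (kind ∘ y))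
    (hn : Fintype.card ι ≤ 2 * (Finset.univ.filter fun i => x i = none).card) :
    Reach Finset.univ 2 x y := by
  set P := Finset.univ.filter fun i => x i = none with hP
  set Q := Finset.univ.filter fun i => y i = none with hQ
  have hPQ : P.card = Q.card := by
    have := hb none
    rwa [card_filter_kind_eq_none, card_filter_kind_eq_none] at this
  have hcard : ((P ∪ Q)ᶜ).card ≤ (P ∩ Q).card := by
    have h1 := Finset.card_union_add_card_inter P Q
    have h2 := Finset.card_compl_add_card (P ∪ Q)
    omega
  obtain ⟨B, hB, hBc⟩ := Finset.exists_subset_card_eq hcard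
  have hd : Disjoint (P ∪ Q)ᶜ B := by
    refine Finset.disjoint_left.2 fun i hi hi' => ?_
    exact Finset.mem_compl.1 hi (Finset.mem_union_left _ (Finset.mem_inter.1 (hB hi')).1)
  obtain ⟨σ, h1, -, h3⟩ := exists_perm_exchange _ B hd hBc.symm
  have hxz : BalancedOn Finset.univ (kind ∘ x) (kind ∘ fun i => x (σ i)) :=
    BalancedOn.of_perm σ fun i => rfl
  have hBx : ∀ i ∈ B, x i = none ∧ y i = none := by
    intro i hi
    simpa [hP, hQ] using hB hi
  have hA : ∀ i ∈ (P ∪ Q)ᶜ, x (σ i) = none := fun i hi => (hBx _ (h1 i hi)).1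
  have hor : ∀ i, i ∉ (P ∪ Q)ᶜ → x i = none ∨ y i = none := by
    intro i hi
    simpa [hP, hQ, or_iff_not_imp_left] using hi
  refine ⟨fun i => x (σ i), fun i _ => ?_, hxz, y, fun i _ => ?_, hxz.symm.trans hb,
    fun i _ => rfl⟩
  · by_cases hi : i ∈ (P ∪ Q)ᶜ
    · exact Or.inr (Or.inl (hA i hi))
    by_cases hi' : i ∈ B
    · exact Or.inl (hBx i hi').1
    · exact Or.inr (Or.inr (congrArg x (h3 i hi hi')).symm)
  · by_cases hi : i ∈ (P ∪ Q)ᶜ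
    · exact Or.inl (hA i hi)
    by_cases hi' : i ∈ B
    · exact Or.inr (Or.inl (hBx i hi').2)
    · have hσ : x (σ i) = x i := congrArg x (h3 i hi hi')
      show x (σ i) = none ∨ y i = none ∨ x (σ i) = y i
      rw [hσ]
      rcases hor i hi with h | h
      · exact Or.inl h
      · exact Or.inr (Or.inl h)

/-! ### Lower bounds -/

/-- The points where both `x` and `y` are defined but differ. -/
def conflictSet (x y : ι → Option ℤ) : Finset ι :=
  Finset.univ.filter fun i => x i ≠ none ∧ y i ≠ none ∧ x i ≠ y i

lemma mem_conflictSet {i : ι} : i ∈ conflictSet x y ↔ x i ≠ none ∧ y i ≠ none ∧ x i ≠ y i := by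
  simp [conflictSet]

lemma Compat.mem_conflictSet (h : Compat Finset.univ x z) {i : ι} (hi : i ∈ conflictSet x y)
    (hz : z i ≠ none) : i ∈ conflictSet z y := by
  rw [_root_.mem_conflictSet] at hi ⊢
  have := ((h i (Finset.mem_univ i)).resolve_left hi.1).resolve_left hz
  rwa [← this]

lemma Reach.card_conflictSet_le {l t : ℕ} (h : Reach Finset.univ (t + 1) x y)
    (hl : (Finset.univ.filter fun i => x i = none).card = l) :
    (conflictSet x y).card ≤ t * l := by
  induction t generalizing x with
  | zero =>
    obtain ⟨z, h1, -, h2⟩ := h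
    rw [zero_mul, Nat.le_zero, Finset.card_eq_zero]
    refine Finset.eq_empty_of_forall_notMem fun i hi => ?_
    rw [mem_conflictSet] at hi
    have h1 := h1 i (Finset.mem_univ i)
    rw [h2 i (Finset.mem_univ i)] at h1
    tauto
  | succ t ih =>
    obtain ⟨z, h1, hb, h2⟩ := h
    have hlz : (Finset.univ.filter fun i => z i = none).card = l := by
      rw [← hl, ← card_filter_kind_eq_none, ← card_filter_kind_eq_none, hb]
    have hsub : conflictSet x y ⊆ conflictSet z y ∪ Finset.univ.filter fun i => z i = none := by
      intro i hi
      by_cases hz : z i = none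
      · exact Finset.mem_union_right _ (by simp [hz])
      · exact Finset.mem_union_left _ (h1.mem_conflictSet hi hz)
    have h3 := (Finset.card_le_card hsub).trans (Finset.card_union_le _ _)
    have h4 := ih h2 hlz
    rw [add_one_mul]
    omega

/-- When a single hole moves from `p` to `p'`, the label lost at `p'` has the kind of the label
gained at `p`. -/
lemma kind_of_hole_move {p p' : ι} (hx : ∀ i, x i = none ↔ i = p)
    (hz : ∀ i, z i = none ↔ i = p') (hne : p ≠ p') (hc : Compat Finset.univ x z)
    (hb : BalancedOn Finset.univ (kind ∘ x) (kind ∘ z)) : kind (x p') = kind (z p) := by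
  have hzp : z p ≠ none := mt (hz p).1 hne
  obtain ⟨i, -, hi1, hi2⟩ := hb.exists_lost (Finset.mem_univ p)
    (by simpa [(hx p).2 rfl, eq_comm, kind_eq_none] using hzp)
  simp only [Function.comp] at hi1 hi2
  have hxi : x i ≠ none := fun h => by
    rw [h, kind_none] at hi1
    exact hzp (kind_eq_none.1 hi1.symm)
  have hip : i = p' := by
    by_contra hip
    have := ((hc i (Finset.mem_univ i)).resolve_left hxi).resolve_left (mt (hz i).1 hip)
    exact hi2 (this ▸ hi1)
  rw [← hip, hi1]

lemma Compat.conflictSet_eq_erase {p : ι} (hc : Compat Finset.univ x z)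
    (hz : ∀ i, z i = none ↔ i = p) (hcard : (conflictSet z y).card < (conflictSet x y).card) :
    p ∈ conflictSet x y ∧ conflictSet z y = (conflictSet x y).erase p := by
  have hsub : (conflictSet x y).erase p ⊆ conflictSet z y := fun i hi =>
    hc.mem_conflictSet (Finset.mem_of_mem_erase hi) (mt (hz i).1 (Finset.ne_of_mem_erase hi))
  have hp : p ∈ conflictSet x y := by
    by_contra hp
    rw [Finset.erase_eq_of_notMem hp] at hsub
    exact absurd (Finset.card_le_card hsub) (not_le.2 hcard)
  refine ⟨hp, (Finset.eq_of_subset_of_card_le hsub ?_).symm⟩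
  rw [Finset.card_erase_of_mem hp]
  omega

/-- If a hole reaches `h` as fast as the number of conflicts allows, then all conflicting labels
are of the kind of the label at `h`. -/
lemma Reach.kind_eq_of_tight {h : ι} (hy : ∀ i, y i = none ↔ i = h) (t : ℕ) :
    ∀ (x : ι → Option ℤ) (p : ι), Reach Finset.univ (t + 1) x y → (∀ i, x i = none ↔ i = p) →
    p ≠ h → (∀ i ∈ conflictSet x y, kind (x i) = kind (y i)) → (conflictSet x y).card = t →
    (∀ i ∈ conflictSet x y, kind (y i) = kind (x h)) ∧ kind (y p) = kind (x h) := by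
  induction t with
  | zero =>
    rintro x p ⟨z, hc, hb, hr⟩ hx hph - hcard
    have hzy : z = y := funext fun i => hr i (Finset.mem_univ i)
    subst hzy
    rw [Finset.card_eq_zero] at hcard
    exact ⟨by simp [hcard], (kind_of_hole_move hx hy hph hc hb).symm⟩
  | succ t ih =>
    rintro x p ⟨z, hc, hb, hr⟩ hx hph hk hcard
    obtain ⟨p', -, hz⟩ := hb.exists_hole (Finset.mem_univ p) fun i _ => hx i
    replace hz : ∀ i, z i = none ↔ i = p' := fun i => hz i (Finset.mem_univ i)
    have hle := hr.card_conflictSet_le (l := 1) (Finset.card_eq_one.2 ⟨p', by ext; simp [hz]⟩)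
    obtain ⟨hp', hE⟩ := hc.conflictSet_eq_erase (y := y) hz (by omega)
    have hp'' := mem_conflictSet.1 hp'
    have hpp' : p ≠ p' := fun h => hp''.1 ((hx p').2 h.symm)
    have hhp' : h ≠ p' := fun h => hp''.2.1 ((hy p').2 h.symm)
    have hzp : z p = y p := by
      by_contra hcon
      have : p ∈ conflictSet z y :=
        mem_conflictSet.2 ⟨mt (hz p).1 hpp', mt (hy p).1 hph, hcon⟩
      rw [hE] at this
      exact (mem_conflictSet.1 (Finset.mem_of_mem_erase this)).1 ((hx p).2 rfl)
    have heq : ∀ i, i ≠ p → i ≠ p' → z i = x i := fun i h1 h2 =>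
      (((hc i (Finset.mem_univ i)).resolve_left (mt (hx i).1 h1)).resolve_left
        (mt (hz i).1 h2)).symm
    have hzh := heq h hph.symm hhp'
    obtain ⟨h1, h2⟩ := ih z p' hr hz hhp'.symm (fun i hi => by
      rw [hE, Finset.mem_erase] at hi
      rw [heq i (fun h => (mem_conflictSet.1 hi.2).1 ((hx i).2 h)) hi.1]
      exact hk i hi.2) (by rw [hE, Finset.card_erase_of_mem hp', hcard]; rfl)
    rw [hzh] at h1 h2
    refine ⟨fun i hi => ?_, ?_⟩
    · rcases eq_or_ne i p' with rfl | hi'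
      · exact h2
      · exact h1 i (hE ▸ Finset.mem_erase.2 ⟨hi', hi⟩)
    · rw [← hzp, ← kind_of_hole_move hx hz hpp' hc hb, hk p' hp', h2]

lemma Reach.exists_kind {h : ι} {t : ℕ} (hr : Reach Finset.univ (t + 2) x y)
    (hx : ∀ i, x i = none ↔ i = h) (hy : ∀ i, y i = none ↔ i = h)
    (hk : ∀ i, kind (x i) = kind (y i)) (hcard : (conflictSet x y).card = t + 1) :
    ∃ c, ∀ i ∈ conflictSet x y, kind (y i) = c := by
  obtain ⟨z, hc, hb, hr⟩ := hr
  obtain ⟨p, -, hz⟩ := hb.exists_hole (Finset.mem_univ h) fun i _ => hx i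
  replace hz : ∀ i, z i = none ↔ i = p := fun i => hz i (Finset.mem_univ i)
  have hle := hr.card_conflictSet_le (l := 1) (Finset.card_eq_one.2 ⟨p, by ext; simp [hz]⟩)
  obtain ⟨hp, hE⟩ := hc.conflictSet_eq_erase (y := y) hz (by omega)
  have hph : p ≠ h := fun h => (mem_conflictSet.1 hp).1 ((hx p).2 h)
  obtain ⟨h1, h2⟩ := Reach.kind_eq_of_tight hy t z p hr hz hph (fun i hi => by
      rw [hE, Finset.mem_erase] at hi
      rw [← ((hc i (Finset.mem_univ i)).resolve_left
        (mem_conflictSet.1 hi.2).1).resolve_left (mt (hz i).1 hi.1)]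
      exact hk i) (by rw [hE, Finset.card_erase_of_mem hp, hcard]; rfl)
  refine ⟨kind (z h), fun i hi => ?_⟩
  rcases eq_or_ne i p with rfl | hi'
  · exact h2
  · exact h1 i (hE ▸ Finset.mem_erase.2 ⟨hi', hi⟩)

end Finset

/-! ### Labels and group elements -/

namespace AffineWeylC

variable {n : ℕ} {x y : Fin n → Option ℤ} {a b : AffineWeylC n}

/-- The product of the labelled negative 1-cycles with labels prescribed by `x`. -/
def ofLabels (x : Fin n → Option ℤ) : AffineWeylC n :=
  ⟨1, fun i => if x i = none then 1 else -1, fun i => (x i).getD 0⟩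

/-- The labels of the negative points of an element. -/
def labels (g : AffineWeylC n) (i : Fin n) : Option ℤ :=
  if g.s i = 1 then none else some (g.v i)

lemma labels_ofLabels (x : Fin n → Option ℤ) : labels (ofLabels x) = x := by
  funext i
  cases h : x i <;> simp [labels, ofLabels, h]

lemma ofLabels_labels (hπ : a.π = 1) (ha : a * a = 1) : ofLabels (labels a) = a := by
  refine AffineWeylC.ext hπ.symm (funext fun i => ?_) (funext fun i => ?_)
  · rcases Int.units_eq_one_or (a.s i) with h | h <;> simp [labels, ofLabels, h]
  · have hv : (a * a).v i = 0 := by rw [ha]; rfl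
    rw [mul_v, hπ] at hv
    rcases Int.units_eq_one_or (a.s i) with h | h
    · simp only [inv_one, Equiv.Perm.one_apply, h, Units.val_one, one_mul] at hv
      simp only [labels, ofLabels, h, if_true, Option.getD_none]
      omega
    · simp [labels, ofLabels, h]

lemma ofLabels_mul_self (x : Fin n → Option ℤ) : ofLabels x * ofLabels x = 1 := by
  refine AffineWeylC.ext rfl (funext fun i => ?_) (funext fun i => ?_) <;>
    cases h : x i <;> simp [ofLabels, h]

lemma commute_ofLabels : Commute (ofLabels x) (ofLabels y) ↔ Compat Finset.univ x y := by
  have key : ∀ i, ((ofLabels x * ofLabels y).v i = (ofLabels y * ofLabels x).v i ↔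
      (x i = none ∨ y i = none ∨ x i = y i)) := by
    intro i
    rw [mul_v, mul_v]
    cases hx : x i <;> cases hy : y i <;> simp [ofLabels, hx, hy]
    omega
  constructor
  · intro h i _
    rw [← key i, h.eq]
  · intro h
    refine AffineWeylC.ext rfl (funext fun i => ?_)
      (funext fun i => (key i).2 (h i (Finset.mem_univ i)))
    exact mul_comm _ _

lemma isConj_ofLabels_of_balancedOn (h : BalancedOn Finset.univ (kind ∘ x) (kind ∘ y)) :
    IsConj (ofLabels x) (ofLabels y) := by
  obtain ⟨σ, hσ⟩ := h.exists_perm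
  simp only [Function.comp] at hσ
  let c : AffineWeylC n := ⟨σ, 1, fun i => ((x i).getD 0 - (y (σ⁻¹ i)).getD 0) / 2⟩
  refine ⟨toUnits c, AffineWeylC.ext ?_ (funext fun j => ?_) (funext fun i => ?_)⟩
  · simp [ofLabels]
  · have : x (σ j) = none ↔ y j = none := by rw [← kind_eq_none, ← kind_eq_none, hσ]
    simp [ofLabels, c, this]
  · obtain ⟨j, rfl⟩ := σ.surjective i
    have hj := hσ j
    cases hx : x (σ j) with
    | none =>
      rw [hx, kind_none, kind_eq_none] at hj
      simp [ofLabels, c, hx, hj]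
    | some z =>
      cases hy : y j with
      | none => simp [hx, hy, kind] at hj
      | some w =>
        simp only [hx, hy, kind, Option.map_some, Option.some.injEq, decide_eq_decide,
          Int.even_iff] at hj
        simp [ofLabels, c, hx, hy]
        omega

lemma isConj_ofLabels : IsConj (ofLabels x) (ofLabels y) ↔
    BalancedOn Finset.univ (kind ∘ x) (kind ∘ y) := by
  refine ⟨?_, isConj_ofLabels_of_balancedOn⟩
  rintro ⟨u, hu⟩
  obtain ⟨c, rfl⟩ := toUnits.surjective u
  have hu : c * ofLabels x = ofLabels y * c := hu
  refine BalancedOn.of_perm c.π fun j => ?_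
  have hs : (c * ofLabels x).s j = (ofLabels y * c).s j := by rw [hu]
  have hv : (c * ofLabels x).v (c.π j) = (ofLabels y * c).v (c.π j) := by rw [hu]
  rcases Int.units_eq_one_or (c.s j) with h | h <;>
  cases hx : x (c.π j) <;> cases hy : y j <;>
    simp [ofLabels, hx, hy, h, kind] at hs hv ⊢ <;>
    simp only [Int.even_iff] <;> omega

lemma exists_ofLabels_of_isConj (h : IsConj (ofLabels x) b) : ∃ y, b = ofLabels y := by
  refine ⟨labels b, (ofLabels_labels ?_ ?_).symm⟩
  · obtain ⟨c, rfl⟩ := isConj_iff.1 h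
    simp [ofLabels]
  · obtain ⟨c, rfl⟩ := isConj_iff.1 h
    have := ofLabels_mul_self x
    rw [← mul_assoc]
    simp [mul_assoc, this]

lemma π_eq_one_of_numTrans (h : numTrans a = 0) : a.π = 1 := by
  have h1 : a.π.support.card < 2 := by
    rw [numTrans, Set.ncard_eq_toFinset_card'] at h
    have : a.π.support = {i : Fin n | a.π i ≠ i}.toFinset := by
      ext i; simp
    rw [this]
    omega
  by_contra hne
  exact absurd (Equiv.Perm.two_le_card_support_of_ne_one hne) (by omega)

lemma numPos_ofLabels : numPos (ofLabels x) = (Finset.univ.filter fun i => x i = none).card := by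
  rw [numPos, Set.ncard_eq_toFinset_card']
  congr 1
  ext i
  cases h : x i <;> simp [ofLabels, h]

lemma numNegEven_ofLabels :
    numNegEven (ofLabels x) = (Finset.univ.filter fun i => (kind ∘ x) i = some true).card := by
  rw [numNegEven, Set.ncard_eq_toFinset_card']
  congr 1
  ext i
  cases h : x i <;> simp [ofLabels, kind, h]

lemma numNegOdd_ofLabels :
    numNegOdd (ofLabels x) = (Finset.univ.filter fun i => (kind ∘ x) i = some false).card := by
  rw [numNegOdd, Set.ncard_eq_toFinset_card']
  congr 1
  ext i
  cases h : x i <;> simp [ofLabels, kind, h]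

end AffineWeylC

section Graph

open AffineWeylC

variable {n : ℕ} {x₀ x y : Fin n → Option ℤ} {t : ℕ}

/-- The vertex of the commuting involution graph with given labels. -/
def labelVertex (x₀ x : Fin n → Option ℤ) (hx : BalancedOn Finset.univ (kind ∘ x₀) (kind ∘ x)) :
    conjClass (ofLabels x₀) :=
  ⟨ofLabels x, isConj_ofLabels.2 hx⟩

lemma labels_labelVertex (hx : BalancedOn Finset.univ (kind ∘ x₀) (kind ∘ x)) :
    labels (labelVertex x₀ x hx).1 = x := labels_ofLabels x

lemma exists_eq_labelVertex (g : conjClass (ofLabels x₀)) : ∃ x hx, g = labelVertex x₀ x hx := by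
  obtain ⟨g, hg⟩ := g
  obtain ⟨x, rfl⟩ := exists_ofLabels_of_isConj hg
  exact ⟨x, isConj_ofLabels.1 hg, rfl⟩

lemma Reach.edist_le (hx : BalancedOn Finset.univ (kind ∘ x₀) (kind ∘ x))
    (hy : BalancedOn Finset.univ (kind ∘ x₀) (kind ∘ y)) (h : Reach Finset.univ t x y) :
    (commGraph (conjClass (ofLabels x₀))).edist (labelVertex x₀ x hx) (labelVertex x₀ y hy) ≤ t := by
  induction t generalizing x with
  | zero =>
    obtain rfl : x = y := funext fun i => h i (Finset.mem_univ i)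
    simp
  | succ t ih =>
    obtain ⟨z, hc, hb, hr⟩ := h
    have hz := hx.trans hb
    refine (SimpleGraph.edist_triangle (v := labelVertex x₀ z hz)).trans ?_
    rw [Nat.cast_add, add_comm (t : ℕ∞)]
    refine add_le_add ?_ (ih hz hr)
    by_cases hxz : ofLabels x = ofLabels z
    · have : labelVertex x₀ x hx = labelVertex x₀ z hz := Subtype.ext hxz
      simp [this]
    · have : (commGraph (conjClass (ofLabels x₀))).Adj (labelVertex x₀ x hx)
          (labelVertex x₀ z hz) := ⟨hxz, commute_ofLabels.2 hc⟩
      exact (SimpleGraph.edist_eq_one_iff_adj.2 this).le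

lemma reach_of_walk {g g' : conjClass (ofLabels x₀)}
    (p : (commGraph (conjClass (ofLabels x₀))).Walk g g') :
    Reach Finset.univ p.length (labels g.1) (labels g'.1) := by
  induction p with
  | nil => exact fun i _ => rfl
  | @cons u v w h p ih =>
    obtain ⟨x, hx, rfl⟩ := exists_eq_labelVertex u
    obtain ⟨z, hz, rfl⟩ := exists_eq_labelVertex v
    refine ⟨z, ?_, ?_, ?_⟩
    · rw [labels_labelVertex]
      exact commute_ofLabels.1 h.2
    · rw [labels_labelVertex]
      exact hx.symm.trans hz
    · rwa [labels_labelVertex] at ih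

lemma reach_of_edist_le (hx : BalancedOn Finset.univ (kind ∘ x₀) (kind ∘ x))
    (hy : BalancedOn Finset.univ (kind ∘ x₀) (kind ∘ y))
    (h : (commGraph (conjClass (ofLabels x₀))).edist (labelVertex x₀ x hx)
      (labelVertex x₀ y hy) ≤ t) : Reach Finset.univ t x y := by
  obtain ⟨p, hp⟩ := SimpleGraph.exists_walk_of_edist_ne_top
    (ne_top_of_le_ne_top (ENat.natCast_ne_top t) h)
  rw [← hp, Nat.cast_le] at h
  have := reach_of_walk p
  rw [labels_labelVertex, labels_labelVertex] at this
  exact this.mono h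

lemma ediam_le_of_reach (h : ∀ x y, BalancedOn Finset.univ (kind ∘ x₀) (kind ∘ x) →
    BalancedOn Finset.univ (kind ∘ x₀) (kind ∘ y) → Reach Finset.univ t x y) :
    (commGraph (conjClass (ofLabels x₀))).ediam ≤ t := by
  refine SimpleGraph.ediam_le_of_edist_le fun g g' => ?_
  obtain ⟨x, hx, rfl⟩ := exists_eq_labelVertex g
  obtain ⟨y, hy, rfl⟩ := exists_eq_labelVertex g'
  exact (h x y hx hy).edist_le hx hy

lemma succ_le_ediam_of_not_reach (hy : BalancedOn Finset.univ (kind ∘ x₀) (kind ∘ y))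
    (h : ¬ Reach Finset.univ t x₀ y) :
    ((t + 1 : ℕ) : ℕ∞) ≤ (commGraph (conjClass (ofLabels x₀))).ediam := by
  by_contra hlt
  have hle := Order.le_of_lt_add_one (y := (t : ℕ∞)) (by simpa using hlt)
  exact h (reach_of_edist_le (BalancedOn.refl _ _) hy (SimpleGraph.edist_le_ediam.trans hle))

/-- Increase every label by two. -/
def shiftLabels (x : Fin n → Option ℤ) (i : Fin n) : Option ℤ := (x i).map (· + 2)

lemma kind_shiftLabels (x : Fin n → Option ℤ) (i : Fin n) :
    kind (shiftLabels x i) = kind (x i) := by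
  cases h : x i <;> simp [shiftLabels, kind, h]

lemma balancedOn_shiftLabels (x : Fin n → Option ℤ) :
    BalancedOn Finset.univ (kind ∘ x) (kind ∘ shiftLabels x) :=
  BalancedOn.of_perm 1 fun i => kind_shiftLabels x i

lemma conflictSet_shiftLabels (x : Fin n → Option ℤ) :
    conflictSet x (shiftLabels x) = Finset.univ.filter fun i => x i ≠ none := by
  ext i
  cases h : x i <;> simp [mem_conflictSet, shiftLabels, h]

lemma card_conflictSet_shiftLabels (x : Fin n → Option ℤ) :
    (conflictSet x (shiftLabels x)).card + (Finset.univ.filter fun i => x i = none).card = n := by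
  rw [conflictSet_shiftLabels, add_comm, Finset.card_filter_add_card_filter_not,
    Finset.card_univ, Fintype.card_fin]

/-- If a kind does not occur among the labels, all labels are of the other kind. -/
lemma BalancedOn.kind_eq_of_card_eq_zero {c : Bool}
    (hx : BalancedOn Finset.univ (kind ∘ x₀) (kind ∘ x))
    (h0 : (Finset.univ.filter fun i => (kind ∘ x₀) i = some (!c)).card = 0) (i : Fin n)
    (hi : x i ≠ none) : kind (x i) = some c := by
  rw [hx, Finset.card_eq_zero, Finset.filter_eq_empty_iff] at h0
  have h1 := h0 (Finset.mem_univ i)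
  cases hk : kind (x i) with
  | none => exact absurd (kind_eq_none.1 hk) hi
  | some d =>
    simp only [Function.comp, hk, Option.some.injEq] at h1
    exact congrArg some (by simpa using h1)

lemma not_reach_shiftLabels {l : ℕ} (hl : (Finset.univ.filter fun i => x i = none).card = l)
    (hn : t * l + 1 ≤ n) (hln : l < n) : ¬ Reach Finset.univ t x (shiftLabels x) := by
  intro h
  have hc := card_conflictSet_shiftLabels x
  have h1 := (h.mono (show t ≤ t - 1 + 1 by omega)).card_conflictSet_le hl
  cases t with
  | zero =>
    rw [Nat.zero_sub, zero_mul] at h1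
    omega
  | succ t =>
    rw [add_one_mul] at hn
    rw [Nat.add_sub_cancel] at h1
    omega

lemma not_reach_shiftLabels_of_single_hole {h : Fin n} (hx : ∀ i, x i = none ↔ i = h)
    (he : ∃ i, kind (x i) = some true) (ho : ∃ i, kind (x i) = some false) :
    ¬ Reach Finset.univ n x (shiftLabels x) := by
  obtain ⟨i, hi⟩ := he
  obtain ⟨j, hj⟩ := ho
  have hc := card_conflictSet_shiftLabels x
  have h1 : (Finset.univ.filter fun i => x i = none).card = 1 :=
    Finset.card_eq_one.2 ⟨h, by ext; simp [hx]⟩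
  have hmem : ∀ k, k ∈ conflictSet x (shiftLabels x) ↔ x k ≠ none := by
    simp [conflictSet_shiftLabels]
  have hi' : i ∈ conflictSet x (shiftLabels x) := (hmem i).2 fun h => by simp [h] at hi
  have hj' : j ∈ conflictSet x (shiftLabels x) := (hmem j).2 fun h => by simp [h] at hj
  have hpos := Finset.card_pos.2 ⟨i, hi'⟩
  obtain ⟨t, rfl⟩ : ∃ t, n = t + 2 := ⟨n - 2, by omega⟩
  intro hr
  obtain ⟨c, hcc⟩ := hr.exists_kind hx (fun k => by rw [← hx, ← kind_eq_none, kind_shiftLabels,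
    kind_eq_none]) (fun k => (kind_shiftLabels x k).symm) (by omega)
  have h2 := (hcc i hi').trans (hcc j hj').symm
  rw [kind_shiftLabels, kind_shiftLabels, hi, hj] at h2
  simp at h2

end Graph

/-- Diameter of the commuting involution graph when `m = 0`
and `l ≥ 1`:  it equals `2` if `2l ≥ n`; it equals `⌈n/l⌉` if one of `k_e, k_o`
vanishes (and `2l < n`); it equals `n+1` if `l = 1` and both `k_e, k_o` are
nonzero; and in all other cases it lies between `⌈n/l⌉` and `⌈n/l⌉ + 2`. -/
theorem stmt_11 (n ke ko l : ℕ) (hl : 1 ≤ l) (a : AffineWeylC n)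
    (ha : a.Involution) (htype : a.HasType 0 ke ko l) (hsum : ke + ko + l = n)
    (X : Set (AffineWeylC n)) (hX : X = AffineWeylC.conjClass a) :
    (n ≤ 2 * l → (commGraph X).ediam = 2) ∧
    (2 * l < n → (ke = 0 ∨ ko = 0) →
      (commGraph X).ediam = (((n + l - 1) / l : ℕ) : ℕ∞)) ∧
    (l = 1 → ke ≠ 0 → ko ≠ 0 → (commGraph X).ediam = (n : ℕ∞) + 1) ∧
    (2 * l < n → ke ≠ 0 → ko ≠ 0 → l ≠ 1 →
      (((n + l - 1) / l : ℕ) : ℕ∞) ≤ (commGraph X).ediam ∧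
        (commGraph X).ediam ≤ (((n + l - 1) / l : ℕ) : ℕ∞) + 2) := by
  subst hX
  obtain ⟨hm, hke, hko, hpos⟩ := htype
  have hax := AffineWeylC.ofLabels_labels (AffineWeylC.π_eq_one_of_numTrans hm) ha.2
  obtain ⟨x₀, rfl⟩ : ∃ x₀, a = AffineWeylC.ofLabels x₀ := ⟨_, hax.symm⟩
  rw [AffineWeylC.numNegEven_ofLabels] at hke
  rw [AffineWeylC.numNegOdd_ofLabels] at hko
  rw [AffineWeylC.numPos_ofLabels] at hpos
  have hln : l < n := by
    by_contra hln
    have hall := Finset.card_eq_zero.1 (hke.trans (by omega : ke = 0))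
    have hall' := Finset.card_eq_zero.1 (hko.trans (by omega : ko = 0))
    rw [Finset.filter_eq_empty_iff] at hall hall'
    have hx : ∀ i, x₀ i = none := fun i => by
      have h1 := hall (Finset.mem_univ i)
      have h2 := hall' (Finset.mem_univ i)
      rw [← kind_eq_none]
      cases hk : kind (x₀ i) with
      | none => rfl
      | some d => cases d <;> simp_all
    exact ha.1 (AffineWeylC.ext rfl (funext fun i => by simp [AffineWeylC.ofLabels, hx])
      (funext fun i => by simp [AffineWeylC.ofLabels, hx]))
  have hcard : ∀ x : Fin n → Option ℤ, BalancedOn Finset.univ (kind ∘ x₀) (kind ∘ x) →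
      (Finset.univ.filter fun i => x i = none).card = l := fun x hx => by
    rw [← hpos, ← card_filter_kind_eq_none, ← card_filter_kind_eq_none, hx]
  obtain ⟨q, hq⟩ : ∃ q, q = (n - 1) / l := ⟨_, rfl⟩
  have hceil : (n + l - 1) / l = q + 1 := by
    rw [hq, ← Nat.add_div_right _ hl]
    congr 1
    omega
  have hql : q * l + 1 ≤ n := by
    have := Nat.div_mul_le_self (n - 1) l
    rw [← hq] at this
    omega
  have hnq : n ≤ (q + 1) * l := by
    have := Nat.lt_div_mul_add (a := n - 1) hl
    rw [← hq] at this
    rw [add_one_mul]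
    omega
  have hlower : ((q + 1 : ℕ) : ℕ∞) ≤
      (commGraph (AffineWeylC.conjClass (AffineWeylC.ofLabels x₀))).ediam :=
    succ_le_ediam_of_not_reach (balancedOn_shiftLabels x₀) (not_reach_shiftLabels hpos hql hln)
  rw [hceil]
  refine ⟨fun h => le_antisymm ?_ ?_, fun h h0 => le_antisymm ?_ hlower,
    fun h1 he ho => le_antisymm ?_ ?_, fun _ _ _ _ => ⟨hlower, ?_⟩⟩
  · exact ediam_le_of_reach (t := 2) fun x y hx hy =>
      reach_two (hx.symm.trans hy) (by rw [hcard x hx, Fintype.card_fin]; exact h)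
  · exact succ_le_ediam_of_not_reach (t := 1) (balancedOn_shiftLabels x₀)
      (not_reach_shiftLabels hpos (by omega) hln)
  · obtain ⟨c, hc⟩ : ∃ c : Bool,
        (Finset.univ.filter fun i => (kind ∘ x₀) i = some (!c)).card = 0 := by
      rcases h0 with h0 | h0
      · exact ⟨false, hke.trans h0⟩
      · exact ⟨true, hko.trans h0⟩
    have hq1 : 1 ≤ q := by
      by_contra hq0
      have : q = 0 := by omega
      subst this
      omega
    exact ediam_le_of_reach fun x y hx hy => reach_of_le_mul_of_kind (hx.symm.trans hy)
      (hx.kind_eq_of_card_eq_zero hc) (hy.kind_eq_of_card_eq_zero hc) hq1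
      (by rw [hcard x hx, Fintype.card_fin]; exact hnq)
  · refine ediam_le_of_reach (t := n + 1) fun x y hx hy => ?_
    obtain ⟨p, hp⟩ := Finset.card_eq_one.1 ((hcard x hx).trans h1)
    have := reach_of_single_hole (hx.symm.trans hy) (h := p) fun i => by
      simpa using Finset.ext_iff.1 hp i
    rwa [Fintype.card_fin] at this
  · obtain ⟨p, hp⟩ := Finset.card_eq_one.1 (hpos.trans h1)
    have hne : ∀ d, (Finset.univ.filter fun i => (kind ∘ x₀) i = some d).card ≠ 0 →
        ∃ i, kind (x₀ i) = some d := fun d hd => by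
      obtain ⟨i, hi⟩ := Finset.card_ne_zero.1 hd
      exact ⟨i, (Finset.mem_filter.1 hi).2⟩
    exact succ_le_ediam_of_not_reach (balancedOn_shiftLabels x₀)
      (not_reach_shiftLabels_of_single_hole (h := p)
        (fun i => by simpa using Finset.ext_iff.1 hp i)
        (hne true (hke ▸ he)) (hne false (hko ▸ ho)))
  · exact ediam_le_of_reach (t := q + 3) fun x y hx hy => reach_of_le_mul (hx.symm.trans hy)
      (by rw [hcard x hx, Fintype.card_fin]; exact hnq)
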